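/- arXiv:2104.00381 — 2 statements merged into one kernel-verified Lean document; each statement's English description precedes it below -/
import Mathlib

section
/- Let n ≥ 2 be an integer and let α, β be positive real numbers satisfying condition (A): β > n + √(n/2), and there exists δ in the open interval J := (β−n−√((β−n)²−n/2), β−n+√((β−n)²−n/2)) such that α > [ (n/2)(2δ+1)((n−1)δ+n) + √D ] / [ 2δ(β−n) − δ² − n/2 ], where D := (nδ/2)(2β+(2n−1)δ)·[ 2δ(β−n) + (n/2)(2n(δ+1)² − (2δ+1)²) ]. Then there exist real numbers p > n/2 and r > 0, σ > 0 such that A₁ > 0 and A₂ < 0, where A₁ is the determinant of the 2×2 matrix with rows (a₁, a₃/2) and (a₃/2, a₆), A₂ is the determinant of the 3×3 matrix with rows (a₁, a₃/2, a₂/2), (a₃/2, a₆, a₅/2), (a₂/2, a₅/2, a₄), and the coefficients are a₁ := −p(p−1), a₂ := p(p+2r−1), a₃ := p(p+2σ−1), a₄ := −r(p+r+α), a₅ := pr+pσ+2rσ, a₆ := −σ(−p+σ+β). -/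
/-- The Schur complement quantity `K(p)`. -/
def auxK (β δ p : ℝ) : ℝ := 2 * δ * (β - 2 * p) - δ ^ 2 - p

/-- The reduced form of the third minor. -/
def auxG (α β δ ρ p : ℝ) : ℝ :=
  auxK β δ p * (2 * ρ * α - ρ ^ 2 - p) - (p * (1 + 2 * δ) + ρ * (2 * p + (2 * p - 1) * δ)) ^ 2

/-- Lemma 3.3: under the structural condition (A) on `α, β`, there exist
`p > n/2`, `r > 0`, `σ > 0` making the two leading principal minors
`A₁ > 0` and `A₂ < 0`. -/
theorem stmt_0 (n : ℕ) (hn : 2 ≤ n) (α β : ℝ) (hα : 0 < α) (hβ : 0 < β)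
    (hβn : β > (n : ℝ) + Real.sqrt ((n : ℝ) / 2))
    (hA : ∃ δ : ℝ,
      δ ∈ Set.Ioo ((β - n) - Real.sqrt ((β - n) ^ 2 - (n : ℝ) / 2))
                  ((β - n) + Real.sqrt ((β - n) ^ 2 - (n : ℝ) / 2)) ∧
      α > (((n : ℝ) / 2) * (2 * δ + 1) * (((n : ℝ) - 1) * δ + n)
            + Real.sqrt (((n : ℝ) * δ / 2) * (2 * β + (2 * (n : ℝ) - 1) * δ)
                * (2 * δ * (β - n)
                    + ((n : ℝ) / 2) * (2 * (n : ℝ) * (δ + 1) ^ 2 - (2 * δ + 1) ^ 2))))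
          / (2 * δ * (β - n) - δ ^ 2 - (n : ℝ) / 2)) :
    ∃ p r σ : ℝ, p > (n : ℝ) / 2 ∧ r > 0 ∧ σ > 0 ∧
      Matrix.det !![-p * (p - 1), p * (p + 2 * σ - 1) / 2;
                    p * (p + 2 * σ - 1) / 2, -σ * (-p + σ + β)] > 0 ∧
      Matrix.det !![-p * (p - 1), p * (p + 2 * σ - 1) / 2, p * (p + 2 * r - 1) / 2;
                    p * (p + 2 * σ - 1) / 2, -σ * (-p + σ + β), (p * r + p * σ + 2 * r * σ) / 2;
                    p * (p + 2 * r - 1) / 2, (p * r + p * σ + 2 * r * σ) / 2,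
                      -r * (p + r + α)] < 0 := by
  obtain ⟨δ, ⟨hδ1, hδ2⟩, hα'⟩ := hA
  have hn2 : (2 : ℝ) ≤ n := by exact_mod_cast hn
  have hs0 : 0 ≤ Real.sqrt ((n : ℝ) / 2) := Real.sqrt_nonneg _
  have hspos : 0 < Real.sqrt ((β - n) ^ 2 - (n : ℝ) / 2) := by linarith
  have hsq := Real.sq_sqrt (Real.sqrt_pos.mp hspos).le
  have hK : 0 < 2 * δ * (β - n) - δ ^ 2 - (n : ℝ) / 2 := by
    have := mul_pos (sub_pos.mpr hδ1) (sub_pos.mpr hδ2)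
    linear_combination this + hsq
  have hδ : 0 < δ := by
    by_contra h
    push Not at h
    nlinarith [mul_nonneg (neg_nonneg.mpr h) (show 0 ≤ β - n by linarith), sq_nonneg δ]
  rw [gt_iff_lt, div_lt_iff₀ hK] at hα'
  set K := 2 * δ * (β - n) - δ ^ 2 - (n : ℝ) / 2 with hKdef
  set D := ((n : ℝ) * δ / 2) * (2 * β + (2 * (n : ℝ) - 1) * δ)
                * (2 * δ * (β - n)
                    + ((n : ℝ) / 2) * (2 * (n : ℝ) * (δ + 1) ^ 2 - (2 * δ + 1) ^ 2)) with hD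
  set b := ((n : ℝ) / 2) * (2 * δ + 1) with hb
  set c := ((n : ℝ) - 1) * δ + n with hc
  have hDeq : D = (K + c ^ 2) * (K * (n / 2) + b ^ 2) := by
    rw [hD, hKdef, hb, hc]; ring
  have hKc : 0 < K + c ^ 2 := by positivity
  have hD0 : 0 ≤ D := by rw [hDeq]; positivity
  have hDs := Real.sq_sqrt hD0
  have hDn := Real.sqrt_nonneg D
  have hm : Real.sqrt D < α * K - b * c := by linarith
  have hm0 : 0 < α * K - b * c := by linarith
  have hm2 : D < (α * K - b * c) ^ 2 := (Real.sqrt_lt' hm0).mp hm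
  obtain ⟨ρ, hρ⟩ : ∃ ρ, ρ = (α * K - b * c) / (K + c ^ 2) := ⟨_, rfl⟩
  have hρ0 : 0 < ρ := by rw [hρ]; positivity
  have hρe : ρ * (K + c ^ 2) = α * K - b * c := by rw [hρ]; field_simp
  have hK1 : 0 < auxK β δ (n / 2) := by
    have : auxK β δ (n / 2) = K := by rw [hKdef, auxK]; ring
    rw [this]; exact hK
  have hG1 : 0 < auxG α β δ ρ (n / 2) := by
    have e : auxG α β δ ρ (n / 2) =
        2 * ρ * (α * K - b * c) - ρ * (ρ * (K + c ^ 2)) - (K * (n / 2) + b ^ 2) := by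
      rw [hKdef, hb, hc, auxG, auxK]; ring
    have e2 : (K + c ^ 2) * auxG α β δ ρ (n / 2) = (α * K - b * c) ^ 2 - D := by
      rw [e, hDeq, ← hρe]; ring
    have : 0 < (K + c ^ 2) * auxG α β δ ρ (n / 2) := by rw [e2]; linarith
    exact pos_of_mul_pos_right this hKc.le
  have cK : Continuous (auxK β δ) := by unfold auxK; fun_prop
  have cG : Continuous (auxG α β δ ρ) := by unfold auxG auxK; fun_prop
  have evK := (cK.tendsto ((n : ℝ) / 2)).eventually (lt_mem_nhds hK1)
  have evG := (cG.tendsto ((n : ℝ) / 2)).eventually (lt_mem_nhds hG1)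
  obtain ⟨p, ⟨hpK, hpG⟩, hp⟩ := (((evK.and evG).filter_mono nhdsWithin_le_nhds).and
    (self_mem_nhdsWithin (a := (n : ℝ) / 2) (s := Set.Ioi ((n : ℝ) / 2)))).exists
  have hp' : (n : ℝ) / 2 < p := hp
  have hq : 0 < p - 1 := by linarith
  have hp0 : 0 < p := by linarith
  refine ⟨p, (p - 1) * ρ / 2, (p - 1) * δ / 2, hp', by positivity, by positivity, ?_, ?_⟩
  · have : 0 < p * (p - 1) ^ 2 / 4 * auxK β δ p := by positivity
    rw [Matrix.det_fin_two_of]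
    convert this using 1
    unfold auxK; ring
  · have : 0 < p * (p - 1) ^ 3 / 16 * auxG α β δ ρ p := by positivity
    have e : ∀ x : ℝ, x = -(p * (p - 1) ^ 3 / 16 * auxG α β δ ρ p) → x < 0 := by
      intro x hx; linarith
    apply e
    rw [Matrix.det_fin_three]
    simp
    unfold auxG auxK; ring
end

section
/- Let n ≥ 2 be an integer and let α, β be positive real numbers satisfying condition (A): β > n + √(n/2), and there exists δ in the open interval J := (β−n−√((β−n)²−n/2), β−n+√((β−n)²−n/2)) such that α > [ (n/2)(2δ+1)((n−1)δ+n) + √D ] / [ 2δ(β−n) − δ² − n/2 ], where D := (nδ/2)(2β+(2n−1)δ)·[ 2δ(β−n) + (n/2)(2n(δ+1)² − (2δ+1)²) ]. Then there exist real numbers p > n/2, r > 0, σ > 0 and ε₀ ∈ (0,1) such that for all real numbers x, y, z: −(1−ε₀)p(p−1)x² + p(p+2r−1)xy + p(p+2σ−1)xz − r(p+r+α)y² + (pr+pσ+2rσ)yz − σ(−p+σ+β)z² ≤ 0. -/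
open Filter Topology

lemma quad_nonpos (a b c y z : ℝ) (hc : c < 0) (h : 0 < 4 * a * c - b ^ 2) :
    a * y ^ 2 + b * (y * z) + c * z ^ 2 ≤ 0 := by
  by_contra hq
  push Not at hq
  have h1 : 4 * c * (a * y ^ 2 + b * (y * z) + c * z ^ 2) < 0 :=
    mul_neg_of_neg_of_pos (by linarith) hq
  nlinarith [sq_nonneg (2 * c * z + b * y), mul_nonneg h.le (sq_nonneg y)]

lemma form_nonpos (A B C Y Z W : ℝ) (hA : 0 < A) (hc : C ^ 2 - 4 * A * W < 0)
    (hd : 0 < 4 * (B ^ 2 - 4 * A * Y) * (C ^ 2 - 4 * A * W) - (2 * B * C + 4 * A * Z) ^ 2) :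
    ∃ ε ∈ Set.Ioo (0 : ℝ) 1, ∀ x y z : ℝ,
      -(1 - ε) * A * x ^ 2 + B * (x * y) + C * (x * z) - Y * y ^ 2 + Z * (y * z) - W * z ^ 2
        ≤ 0 := by
  have e1 : ∀ᶠ ε in 𝓝 (0 : ℝ), C ^ 2 - 4 * ((1 - ε) * A) * W < 0 := by
    have : ContinuousAt (fun ε : ℝ => C ^ 2 - 4 * ((1 - ε) * A) * W) 0 := by fun_prop
    exact this.eventually_lt_const (by simpa using hc)
  have e2 : ∀ᶠ ε in 𝓝 (0 : ℝ), 0 < 4 * (B ^ 2 - 4 * ((1 - ε) * A) * Y) *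
      (C ^ 2 - 4 * ((1 - ε) * A) * W) - (2 * B * C + 4 * ((1 - ε) * A) * Z) ^ 2 := by
    have : ContinuousAt (fun ε : ℝ => 4 * (B ^ 2 - 4 * ((1 - ε) * A) * Y) *
      (C ^ 2 - 4 * ((1 - ε) * A) * W) - (2 * B * C + 4 * ((1 - ε) * A) * Z) ^ 2) 0 := by fun_prop
    exact this.eventually_const_lt (by simpa using hd)
  have e3 : ∀ᶠ ε in 𝓝[>] (0 : ℝ), ε ∈ Set.Ioo (0 : ℝ) 1 := Ioo_mem_nhdsGT one_pos
  obtain ⟨ε, h3, h1, h2⟩ := (e3.and ((e1.and e2).filter_mono nhdsWithin_le_nhds)).exists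
  refine ⟨ε, h3, fun x y z => ?_⟩
  have ht : 0 < (1 - ε) * A := mul_pos (by linarith [h3.2]) hA
  have hq := quad_nonpos _ _ _ y z h1 h2
  rw [neg_mul]
  generalize (1 - ε) * A = T at *
  by_contra hn
  push Not at hn
  have := mul_pos ht hn
  nlinarith [sq_nonneg (2 * T * x - (B * y + C * z))]

lemma exists_R (N α β δ : ℝ) (hN : 2 ≤ N) (hδ : 0 < δ)
    (hK : 0 < 2 * δ * (β - N) - δ ^ 2 - N / 2)
    (h : α > ((N / 2) * (2 * δ + 1) * ((N - 1) * δ + N)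
            + Real.sqrt ((N * δ / 2) * (2 * β + (2 * N - 1) * δ)
                * (2 * δ * (β - N)
                    + (N / 2) * (2 * N * (δ + 1) ^ 2 - (2 * δ + 1) ^ 2))))
          / (2 * δ * (β - N) - δ ^ 2 - N / 2)) :
    ∃ R : ℝ, 0 < R ∧
      0 < 4 * (N / 2 / 4 + R ^ 2 - R * α) *
        (N / 2 / 4 + 2 * (N / 2) * (δ / 2) + (δ / 2) ^ 2 - δ / 2 * β)
        - (N / 2 / 2 + 2 * (N / 2) * (R + δ / 2) + 2 * R * (δ / 2) * (2 * (N / 2) - 1)) ^ 2 := by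
  rw [gt_iff_lt, div_lt_iff₀ hK] at h
  set K := 2 * δ * (β - N) - δ ^ 2 - N / 2 with hKd
  set B0 := N * (2 * δ + 1) / 4 with hB0
  set B1 := (N - 1) * δ + N with hB1
  have hD : (N * δ / 2) * (2 * β + (2 * N - 1) * δ) * (2 * δ * (β - N)
      + (N / 2) * (2 * N * (δ + 1) ^ 2 - (2 * δ + 1) ^ 2))
      = 4 * (K + B1 ^ 2) * (B0 ^ 2 + K * N / 8) := by
    rw [hKd, hB0, hB1]; ring
  rw [hD] at h
  have hP : 0 < K + B1 ^ 2 := by positivity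
  have hQ : 0 < B0 ^ 2 + K * N / 8 := by positivity
  have hB1p : 0 < B1 := by
    have := mul_pos (show 0 < N - 1 by linarith) hδ
    rw [hB1]; linarith
  have hB0p : 0 < B0 := by positivity
  have hL : √(4 * (K + B1 ^ 2) * (B0 ^ 2 + K * N / 8)) < α * K - 2 * B0 * B1 := by
    have : N / 2 * (2 * δ + 1) * B1 = 2 * B0 * B1 := by rw [hB0]; ring
    linarith
  have hL0 : 0 < α * K - 2 * B0 * B1 := lt_of_le_of_lt (Real.sqrt_nonneg _) hL
  rw [Real.sqrt_lt' hL0] at hL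
  set L := α * K - 2 * B0 * B1 with hLd
  refine ⟨L / (2 * (K + B1 ^ 2)), by positivity, ?_⟩
  have hR : L / (2 * (K + B1 ^ 2)) * (2 * (K + B1 ^ 2)) = L := by field_simp
  generalize L / (2 * (K + B1 ^ 2)) = R at *
  have key : 0 < -(R ^ 2 * (K + B1 ^ 2) - R * L + (B0 ^ 2 + K * N / 8)) := by
    by_contra hc
    push Not at hc
    have := mul_nonneg (show (0:ℝ) ≤ 4 * (K + B1 ^ 2) by positivity) (neg_nonneg.2 hc)
    rw [← hR] at hL
    rw [← hR] at this
    nlinarith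
  have : 4 * (N / 2 / 4 + R ^ 2 - R * α) *
        (N / 2 / 4 + 2 * (N / 2) * (δ / 2) + (δ / 2) ^ 2 - δ / 2 * β)
        - (N / 2 / 2 + 2 * (N / 2) * (R + δ / 2) + 2 * R * (δ / 2) * (2 * (N / 2) - 1)) ^ 2
      = -(R ^ 2 * (K + B1 ^ 2) - R * L + (B0 ^ 2 + K * N / 8)) := by
    rw [hLd, hKd, hB0, hB1]; ring
  rw [this]; exact key

/-- Lemma 3.3 + Sylvester criterion (proof of Lemma 3.4): under condition (A)
there exist `p > n/2`, `r, σ > 0` and `ε₀ ∈ (0,1)` such that the perturbed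
quadratic form is negative semidefinite. -/
theorem stmt_1 (n : ℕ) (hn : 2 ≤ n) (α β : ℝ) (hα : 0 < α) (hβ : 0 < β)
    (hβn : β > (n : ℝ) + Real.sqrt ((n : ℝ) / 2))
    (hA : ∃ δ : ℝ,
      δ ∈ Set.Ioo ((β - n) - Real.sqrt ((β - n) ^ 2 - (n : ℝ) / 2))
                  ((β - n) + Real.sqrt ((β - n) ^ 2 - (n : ℝ) / 2)) ∧
      α > (((n : ℝ) / 2) * (2 * δ + 1) * (((n : ℝ) - 1) * δ + n)
            + Real.sqrt (((n : ℝ) * δ / 2) * (2 * β + (2 * (n : ℝ) - 1) * δ)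
                * (2 * δ * (β - n)
                    + ((n : ℝ) / 2) * (2 * (n : ℝ) * (δ + 1) ^ 2 - (2 * δ + 1) ^ 2))))
          / (2 * δ * (β - n) - δ ^ 2 - (n : ℝ) / 2)) :
    ∃ p r σ ε₀ : ℝ, p > (n : ℝ) / 2 ∧ r > 0 ∧ σ > 0 ∧ ε₀ ∈ Set.Ioo (0 : ℝ) 1 ∧
      ∀ x y z : ℝ,
        -(1 - ε₀) * p * (p - 1) * x ^ 2 + p * (p + 2 * r - 1) * (x * y)
          + p * (p + 2 * σ - 1) * (x * z) - r * (p + r + α) * y ^ 2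
          + (p * r + p * σ + 2 * r * σ) * (y * z) - σ * (-p + σ + β) * z ^ 2 ≤ 0 := by
  obtain ⟨δ, ⟨hδ1, hδ2⟩, h⟩ := hA
  have hN : (2 : ℝ) ≤ n := by exact_mod_cast hn
  generalize (n : ℝ) = N at *
  have hb : √(N / 2) < β - N := by linarith
  have hb0 : 0 < β - N := lt_of_le_of_lt (Real.sqrt_nonneg _) hb
  have hb2 : N / 2 < (β - N) ^ 2 := (Real.sqrt_lt' hb0).1 hb
  have hs : √((β - N) ^ 2 - N / 2) < β - N := by
    rw [Real.sqrt_lt' hb0]; linarith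
  have hs2 := Real.sq_sqrt (show 0 ≤ (β - N) ^ 2 - N / 2 by linarith)
  generalize √((β - N) ^ 2 - N / 2) = s at *
  have hδ : 0 < δ := by linarith
  have hK : 0 < 2 * δ * (β - N) - δ ^ 2 - N / 2 := by
    nlinarith [mul_pos (sub_pos.2 hδ1) (sub_pos.2 hδ2)]
  obtain ⟨R, hR, hf⟩ := exists_R N α β δ hN hδ hK h
  have e1 : ∀ᶠ p in 𝓝 (N / 2), 0 < 4 * (p / 4 + R ^ 2 - R * α) *
        (p / 4 + 2 * p * (δ / 2) + (δ / 2) ^ 2 - δ / 2 * β)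
        - (p / 2 + 2 * p * (R + δ / 2) + 2 * R * (δ / 2) * (2 * p - 1)) ^ 2 := by
    have : ContinuousAt (fun p : ℝ => 4 * (p / 4 + R ^ 2 - R * α) *
        (p / 4 + 2 * p * (δ / 2) + (δ / 2) ^ 2 - δ / 2 * β)
        - (p / 2 + 2 * p * (R + δ / 2) + 2 * R * (δ / 2) * (2 * p - 1)) ^ 2) (N / 2) := by
      fun_prop
    exact this.eventually_const_lt hf
  have e2 : ∀ᶠ p in 𝓝 (N / 2), p / 4 + 2 * p * (δ / 2) + (δ / 2) ^ 2 - δ / 2 * β < 0 := by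
    have : ContinuousAt (fun p : ℝ => p / 4 + 2 * p * (δ / 2) + (δ / 2) ^ 2 - δ / 2 * β)
        (N / 2) := by fun_prop
    exact this.eventually_lt_const (by linarith)
  have e3 : ∀ᶠ p in 𝓝[>] (N / 2), N / 2 < p := self_mem_nhdsWithin
  obtain ⟨p, h3, h1, h2⟩ := (e3.and ((e1.and e2).filter_mono nhdsWithin_le_nhds)).exists
  have hp1 : 0 < p - 1 := by linarith
  have hp : 0 < p := by linarith
  have hA : 0 < p * (p - 1) := by positivity
  obtain ⟨ε, hε, H⟩ := form_nonpos (p * (p - 1)) (p * (p + 2 * ((p - 1) * R) - 1))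
    (p * (p + 2 * ((p - 1) * (δ / 2)) - 1)) ((p - 1) * R * (p + (p - 1) * R + α))
    (p * ((p - 1) * R) + p * ((p - 1) * (δ / 2)) + 2 * ((p - 1) * R) * ((p - 1) * (δ / 2)))
    ((p - 1) * (δ / 2) * (-p + (p - 1) * (δ / 2) + β)) hA
    (by
      have := mul_neg_of_pos_of_neg (show 0 < 4 * p * (p - 1) ^ 2 by positivity) h2
      linarith)
    (by
      have := mul_pos (show 0 < (4 * p * (p - 1) ^ 2) ^ 2 by positivity) h1
      linarith)
  refine ⟨p, (p - 1) * R, (p - 1) * (δ / 2), ε, h3, by positivity, by positivity, hε,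
    fun x y z => ?_⟩
  have := H x y z
  linarith
end
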